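/- arXiv:1301.2613 — 5 statements merged into one kernel-verified Lean document; each statement's English description precedes it below -/
import Mathlib

section
/- Let ρ > 0 and let ε ≥ 1 be an integer. Then ∫_0^∞ log_2(1+x) · (d/dx)(1 − e^{−x/ρ})^ε dx = (ε/ln 2) Σ_{ℓ=0}^{ε−1} binom(ε−1, ℓ) ((−1)^ℓ/(ℓ+1)) e^{(ℓ+1)/ρ} E_1((ℓ+1)/ρ), where E_1(z) = ∫_z^∞ e^{−t}/t dt. -/
open Finset Real MeasureTheory

/-- The exponential integral of the first order, `E₁(z) = ∫ z^∞ e^{-t}/t dt`. -/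
noncomputable def expInt1 (z : ℝ) : ℝ := ∫ t in Set.Ioi z, Real.exp (-t) / t

open Filter Topology

lemma log_one_add_le_self {x : ℝ} (hx : 0 ≤ x) : Real.log (1 + x) ≤ x := by
  linarith [Real.log_le_sub_one_of_pos (show 0 < 1 + x by linarith)]

lemma integrableOn_log_one_add_mul_exp_neg {a : ℝ} (ha : 0 < a) :
    IntegrableOn (fun x : ℝ => Real.log (1 + x) * Real.exp (-a * x)) (Set.Ioi 0) := by
  have h := integrableOn_rpow_mul_exp_neg_mul_rpow (p := 1) (s := 1) (by norm_num) one_pos ha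
  simp only [Real.rpow_one] at h
  refine Integrable.mono' h (by fun_prop) ?_
  filter_upwards [ae_restrict_mem measurableSet_Ioi] with x hx
  have hx : 0 < x := hx
  have h0 : 0 ≤ Real.log (1 + x) := Real.log_nonneg (by linarith)
  rw [Real.norm_of_nonneg (by positivity)]
  gcongr
  exact log_one_add_le_self hx.le

lemma tendsto_log_one_add_mul_exp_neg_atTop {a : ℝ} (ha : 0 < a) :
    Tendsto (fun x : ℝ => Real.log (1 + x) * Real.exp (-a * x)) atTop (𝓝 0) := by
  have h := tendsto_rpow_mul_exp_neg_mul_atTop_nhds_zero 1 a ha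
  simp only [Real.rpow_one] at h
  refine tendsto_of_tendsto_of_tendsto_of_le_of_le' tendsto_const_nhds h ?_ ?_
  · filter_upwards [eventually_ge_atTop 0] with x hx
    have h0 : 0 ≤ Real.log (1 + x) := Real.log_nonneg (by linarith)
    positivity
  · filter_upwards [eventually_ge_atTop 0] with x hx
    gcongr
    exact log_one_add_le_self hx

lemma integral_exp_neg_div_one_add {a : ℝ} (ha : 0 < a) :
    ∫ x in Set.Ioi (0 : ℝ), Real.exp (-a * x) / (1 + x) = Real.exp a * expInt1 a := by
  have h1 := integral_comp_mul_left_Ioi' (fun t : ℝ => Real.exp (-t) / t) 1 ha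
  have h2 := (measurePreserving_add_right volume (1 : ℝ)).setIntegral_preimage_emb
    (measurableEmbedding_addRight 1) (fun x : ℝ => Real.exp (-(a * x)) / (a * x)) (Set.Ioi 1)
  rw [mul_one, ← h2, Set.preimage_add_const_Ioi, sub_self, smul_eq_mul] at h1
  rw [expInt1, ← h1, ← integral_const_mul, ← integral_const_mul]
  refine setIntegral_congr_fun measurableSet_Ioi fun x hx => ?_
  have hx : 0 < x := hx
  have h3 : Real.exp (-a * x) = Real.exp a * Real.exp (-(a * (x + 1))) := by
    rw [← Real.exp_add]; ring_nf
  simp only [h3]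
  field_simp
  ring

lemma integral_log_one_add_mul_exp_neg {a : ℝ} (ha : 0 < a) :
    ∫ x in Set.Ioi (0 : ℝ), Real.log (1 + x) * Real.exp (-a * x)
      = Real.exp a * expInt1 a / a := by
  have hint : IntegrableOn (fun x : ℝ => Real.exp (-a * x) / (1 + x)) (Set.Ioi 0) := by
    refine Integrable.mono' (integrableOn_exp_mul_Ioi (neg_lt_zero.mpr ha) 0)
      (Measurable.aestronglyMeasurable (by fun_prop)) ?_
    filter_upwards [ae_restrict_mem measurableSet_Ioi] with x hx
    have hx : 0 < x := hx
    rw [Real.norm_of_nonneg (by positivity)]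
    exact div_le_self (by positivity) (by linarith)
  have key := integral_Ioi_mul_deriv_eq_deriv_mul (a := (0 : ℝ)) (a' := (0 : ℝ)) (b' := (0 : ℝ))
    (u := fun x : ℝ => Real.log (1 + x)) (u' := fun x => 1 / (1 + x))
    (v := fun x => -(Real.exp (-a * x) / a)) (v' := fun x => Real.exp (-a * x))
    ?_ ?_ (integrableOn_log_one_add_mul_exp_neg ha) ?_ ?_ ?_
  · rw [key, sub_self, zero_sub, ← integral_neg, ← integral_exp_neg_div_one_add ha,
      ← integral_div]
    congr 1 with x
    ring
  · intro x hx
    have hx : 0 < x := hx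
    exact ((hasDerivAt_id x).const_add 1).log (by simp only [id]; positivity)
  · intro x _
    refine ((((hasDerivAt_id x).const_mul (-a)).exp.div_const a).neg).congr_deriv ?_
    simp only [id]
    field_simp
  · refine (hint.div_const a).neg.congr (ae_of_all _ fun x => ?_)
    simp only [Pi.mul_apply, Pi.neg_apply]
    ring
  · have hc : ContinuousAt (fun x : ℝ => Real.log (1 + x) * -(Real.exp (-a * x) / a)) 0 := by
      fun_prop (disch := norm_num)
    simpa [ContinuousAt, Pi.mul_def] using hc.tendsto.mono_left nhdsWithin_le_nhds
  · have h := ((tendsto_log_one_add_mul_exp_neg_atTop ha).div_const a).neg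
    simp only [zero_div, neg_zero] at h
    refine h.congr fun x => ?_
    simp only [Pi.mul_apply]
    ring

lemma deriv_one_sub_exp_neg_div_pow (ρ : ℝ) (n : ℕ) (x : ℝ) :
    deriv (fun y => (1 - Real.exp (-y / ρ)) ^ (n + 1)) x
      = ∑ l ∈ Finset.range (n + 1),
        ((n + 1 : ℝ) / ρ * ((n.choose l : ℝ) * (-1) ^ l)) * Real.exp (-((l + 1) / ρ) * x) := by
  have h : HasDerivAt (fun y => (1 - Real.exp (-y / ρ)) ^ (n + 1))
      ((n + 1 : ℝ) / ρ * Real.exp (-x / ρ) * (-Real.exp (-x / ρ) + 1) ^ n) x := by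
    refine (((((hasDerivAt_id x).neg.div_const ρ).exp).const_sub 1).pow (n + 1)).congr_deriv ?_
    simp only [id, Pi.neg_apply, Nat.add_sub_cancel]
    push_cast
    ring
  rw [h.deriv, add_pow, Finset.mul_sum]
  refine Finset.sum_congr rfl fun l _ => ?_
  have h3 : Real.exp (-((l + 1) / ρ) * x) = Real.exp (-x / ρ) ^ l * Real.exp (-x / ρ) := by
    rw [← pow_succ, ← Real.exp_nat_mul]
    push_cast
    ring_nf
  rw [h3, neg_pow, one_pow]
  ring

theorem noise_limited_rate_integral (ρ : ℝ) (hρ : 0 < ρ) (ε : ℕ) (hε : 1 ≤ ε) :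
    ∫ x in Set.Ioi (0 : ℝ),
        Real.logb 2 (1 + x) * deriv (fun y => (1 - Real.exp (-y / ρ)) ^ ε) x
      = ((ε : ℝ) / Real.log 2) * ∑ l ∈ Finset.range ε,
          ((ε - 1).choose l : ℝ) * ((-1 : ℝ) ^ l / (l + 1)) *
            Real.exp ((l + 1) / ρ) * expInt1 ((l + 1) / ρ) := by
  obtain ⟨n, rfl⟩ := Nat.exists_eq_add_of_le' hε
  have hpos (l : ℕ) : 0 < ((l : ℝ) + 1) / ρ := by positivity
  have hfun (x : ℝ) : Real.logb 2 (1 + x) * deriv (fun y => (1 - Real.exp (-y / ρ)) ^ (n + 1)) x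
      = ∑ l ∈ Finset.range (n + 1),
        ((n + 1 : ℝ) / ρ * ((n.choose l : ℝ) * (-1) ^ l) / Real.log 2) *
          (Real.log (1 + x) * Real.exp (-((l + 1) / ρ) * x)) := by
    rw [deriv_one_sub_exp_neg_div_pow, Finset.mul_sum, Real.logb]
    exact Finset.sum_congr rfl fun l _ => by ring
  simp only [hfun]
  rw [integral_finsetSum _ fun l _ =>
    (integrableOn_log_one_add_mul_exp_neg (hpos l)).const_mul _, Finset.mul_sum]
  refine Finset.sum_congr rfl fun l _ => ?_
  rw [integral_const_mul, integral_log_one_add_mul_exp_neg (hpos l), Nat.add_sub_cancel]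
  push_cast
  have hl : (l : ℝ) + 1 ≠ 0 := by positivity
  field_simp
end

section
/- Let 1 ≤ M ≤ N be integers and set ξ_1(N,M,m) = Σ_{i=m}^{M−1} ((M−i)/M) binom(N,i) binom(i,m) (−1)^{i−m} for 0 ≤ m ≤ M−1. Let F : ℝ → ℝ be differentiable with derivative f, suppose 0 ≤ F(x) < 1 for all x, F(x) → 1 as x → ∞, f(x) > 0 for all sufficiently large x, and lim_{x→∞} x f(x)/(1 − F(x)) = φ for some φ > 0. Define F_Y(x) = Σ_{m=0}^{M−1} ξ_1(N,M,m) F(x)^{N−m} and f_Y(x) = Σ_{m=0}^{M−1} ξ_1(N,M,m)(N−m) F(x)^{N−m−1} f(x) (so f_Y is the derivative of F_Y). Then lim_{x→∞} x f_Y(x)/(1 − F_Y(x)) = φ. -/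
open Filter Finset

/-- The best-M feedback coefficient ξ₁(N, M, m). -/
noncomputable def xi1 (N M m : ℕ) : ℝ :=
  ∑ i ∈ Finset.Icc m (M - 1),
    (((M : ℝ) - i) / M) * (N.choose i) * (i.choose m) * (-1 : ℝ) ^ (i - m)

/-- The best-`M` transform rewritten in the Bernstein basis. -/
theorem sum_xi1_mul_pow_eq_bernstein (N M : ℕ) (hMN : M ≤ N) (t : ℝ) :
    ∑ m ∈ Finset.range M, xi1 N M m * t ^ (N - m) =
      ∑ i ∈ Finset.range M, (((M : ℝ) - i) / M) * (N.choose i) * (t ^ (N - i) * (1 - t) ^ i) := by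
  have expand (i : ℕ) (hi : i ≤ N) : t ^ (N - i) * (1 - t) ^ i =
      ∑ m ∈ Finset.range (i + 1), (i.choose m : ℝ) * (-1) ^ (i - m) * t ^ (N - m) := by
    rw [sub_eq_add_neg, add_pow, Finset.mul_sum]
    refine Finset.sum_congr rfl fun m hm => ?_
    have hm' : m ≤ i := Nat.lt_succ_iff.mp (Finset.mem_range.mp hm)
    rw [show N - m = (N - i) + (i - m) by omega, pow_add, neg_pow t]
    ring
  calc
    _ = ∑ m ∈ Finset.range M, ∑ i ∈ Finset.Icc m (M - 1),
        (((M : ℝ) - i) / M) * (N.choose i) *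
          ((i.choose m : ℝ) * (-1) ^ (i - m) * t ^ (N - m)) := by
      refine Finset.sum_congr rfl fun m _ => ?_
      rw [xi1, Finset.sum_mul]
      exact Finset.sum_congr rfl fun i _ => by ring
    _ = ∑ i ∈ Finset.range M, ∑ m ∈ Finset.range (i + 1),
        (((M : ℝ) - i) / M) * (N.choose i) *
          ((i.choose m : ℝ) * (-1) ^ (i - m) * t ^ (N - m)) := by
      refine Finset.sum_comm' fun m i => ?_
      simp only [Finset.mem_range, Finset.mem_Icc]
      omega
    _ = _ := by
      refine Finset.sum_congr rfl fun i hi => ?_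
      rw [expand i ((Finset.mem_range.mp hi).le.trans hMN), Finset.mul_sum]

theorem sum_xi1_eq_one (N M : ℕ) (hM : 1 ≤ M) (hMN : M ≤ N) :
    ∑ m ∈ Finset.range M, xi1 N M m = 1 := by
  have h := sum_xi1_mul_pow_eq_bernstein N M hMN 1
  obtain ⟨k, rfl⟩ := Nat.exists_eq_add_of_le' hM
  simp only [one_pow, mul_one, sub_self] at h
  rw [h, Finset.sum_range_succ']
  have : ((k : ℝ) + 1) ≠ 0 := by positivity
  simp [this]

theorem hasDerivAt_sum_xi1_mul_pow (N M : ℕ) (hMN : M ≤ N) (t : ℝ) :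
    HasDerivAt (fun t : ℝ => ∑ m ∈ Finset.range M, xi1 N M m * t ^ (N - m))
      (∑ m ∈ Finset.range M, xi1 N M m * (N - m : ℝ) * t ^ (N - m - 1)) t := by
  refine HasDerivAt.fun_sum fun m hm => ?_
  have h := (hasDerivAt_pow (N - m) t).const_mul (xi1 N M m)
  rwa [Nat.cast_sub ((Finset.mem_range.mp hm).le.trans hMN), ← mul_assoc] at h

/-- The derivative of the best-`M` transform at `1` is `N / M`. -/
theorem sum_xi1_mul_sub_eq_div (N M : ℕ) (hM : 1 ≤ M) (hMN : M ≤ N) :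
    ∑ m ∈ Finset.range M, xi1 N M m * (N - m : ℝ) = N / M := by
  have hleft := hasDerivAt_sum_xi1_mul_pow N M hMN 1
  rw [funext (sum_xi1_mul_pow_eq_bernstein N M hMN)] at hleft
  have hright : HasDerivAt (fun t : ℝ => ∑ i ∈ Finset.range M,
      (((M : ℝ) - i) / M) * (N.choose i) * (t ^ (N - i) * (1 - t) ^ i))
      (∑ i ∈ Finset.range M, (((M : ℝ) - i) / M) * (N.choose i) *
        (((N - i : ℕ) : ℝ) * 0 ^ i - i * 0 ^ (i - 1))) 1 := by
    refine HasDerivAt.fun_sum fun i _ => HasDerivAt.const_mul _ ?_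
    convert (hasDerivAt_pow (N - i) (1 : ℝ)).fun_mul
      (((hasDerivAt_id (1 : ℝ)).const_sub 1).fun_pow i) using 1
    · simp
    · simp [sub_eq_add_neg]
  have h := hleft.unique hright
  simp only [one_pow, mul_one] at h
  rw [h]
  obtain ⟨k, rfl⟩ := Nat.exists_eq_add_of_le' hM
  have hk : ((k : ℝ) + 1) ≠ 0 := by positivity
  rw [Finset.sum_range_succ']
  cases k with
  | zero => simp
  | succ k =>
    rw [Finset.sum_range_succ']
    push_cast at hk ⊢
    simp
    field_simp
    ring

theorem bestM_preserves_frechet_condition (N M : ℕ) (hM : 1 ≤ M) (hMN : M ≤ N)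
    (F f : ℝ → ℝ) (hderiv : ∀ x, HasDerivAt F (f x) x)
    (hF01 : ∀ x, 0 ≤ F x ∧ F x < 1)
    (hFlim : Tendsto F atTop (nhds 1))
    (hfpos : ∀ᶠ x in atTop, 0 < f x)
    (φ : ℝ) (hφ : 0 < φ)
    (hvonMises : Tendsto (fun x => x * f x / (1 - F x)) atTop (nhds φ))
    (FY fY : ℝ → ℝ)
    (hFY : ∀ x, FY x = ∑ m ∈ Finset.range M, xi1 N M m * (F x) ^ (N - m))
    (hfY : ∀ x, fY x = ∑ m ∈ Finset.range M, xi1 N M m * (N - m : ℝ) * (F x) ^ (N - m - 1) * f x) :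
    Tendsto (fun x => x * fY x / (1 - FY x)) atTop (nhds φ) := by
  set p : ℝ → ℝ := fun t => ∑ m ∈ Finset.range M, xi1 N M m * t ^ (N - m) with hp
  set dp : ℝ → ℝ :=
    fun t => ∑ m ∈ Finset.range M, xi1 N M m * (N - m : ℝ) * t ^ (N - m - 1) with hdp
  have hp1 : p 1 = 1 := by simpa [hp] using sum_xi1_eq_one N M hM hMN
  have hdp1 : dp 1 = N / M := by simpa [hdp] using sum_xi1_mul_sub_eq_div N M hM hMN
  have hne : dp 1 ≠ 0 := by
    rw [hdp1]
    have hM' : (M : ℝ) ≠ 0 := by exact_mod_cast (by omega : M ≠ 0)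
    have hN' : (N : ℝ) ≠ 0 := by exact_mod_cast (by omega : N ≠ 0)
    exact div_ne_zero hN' hM'
  have hcont : Continuous dp := by fun_prop
  have hF1 : Tendsto F atTop (nhdsWithin 1 {1}ᶜ) :=
    tendsto_nhdsWithin_iff.mpr ⟨hFlim, .of_forall fun x => (hF01 x).2.ne⟩
  have hslope : Tendsto (fun x => slope p 1 (F x)) atTop (nhds (dp 1)) :=
    (hasDerivAt_iff_tendsto_slope.mp (hasDerivAt_sum_xi1_mul_pow N M hMN 1)).comp hF1
  have hdpF : Tendsto (fun x => dp (F x)) atTop (nhds (dp 1)) :=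
    (hcont.tendsto 1).comp hFlim
  have hlim := hvonMises.mul (hdpF.div hslope hne)
  rw [div_self hne, mul_one] at hlim
  refine hlim.congr fun x => ?_
  have hfYx : fY x = dp (F x) * f x := by rw [hfY, hdp, Finset.sum_mul]
  have hFYx : FY x = p (F x) := hFY x
  have hFx : 1 - F x ≠ 0 := (sub_pos.mpr (hF01 x).2).ne'
  have hslopex : slope p 1 (F x) = (1 - p (F x)) / (1 - F x) := by
    rw [slope_def_field, hp1, ← neg_sub 1 (p (F x)), ← neg_sub 1 (F x), neg_div_neg_eq]
  simp only [Pi.div_apply]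
  rw [hfYx, hFYx, hslopex]
  field_simp
end

section
/- Let 1 ≤ M ≤ N be integers and set ξ_1(N,M,m) = Σ_{i=m}^{M−1} ((M−i)/M) binom(N,i) binom(i,m) (−1)^{i−m} for 0 ≤ m ≤ M−1. Let F : ℝ → ℝ be twice differentiable with first derivative f and second derivative f', suppose 0 ≤ F(x) < 1 for all x, F(x) → 1 as x → ∞, f(x) > 0 for all sufficiently large x, and lim_{x→∞} (F(x) − 1) f'(x)/f(x)^2 = 1. Define F_Y(x) = Σ_{m=0}^{M−1} ξ_1(N,M,m) F(x)^{N−m}, f_Y(x) = Σ_{m=0}^{M−1} ξ_1(N,M,m)(N−m) F(x)^{N−m−1} f(x), and f_Y'(x) = Σ_{m=0}^{M−1} ξ_1(N,M,m)(N−m) [ (N−m−1) F(x)^{N−m−2} f(x)^2 + F(x)^{N−m−1} f'(x) ]. Then lim_{x→∞} (F_Y(x) − 1) f_Y'(x)/f_Y(x)^2 = 1. -/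
open Filter Finset

open Polynomial in
/-- The polynomial whose value at `F x` is the best-`M` transform of `F`. -/
noncomputable def bestMPoly (N M : ℕ) : ℝ[X] :=
  ∑ m ∈ Finset.range M, C (xi1 N M m) * X ^ (N - m)

open Polynomial in
theorem bestMPoly_eq_sum_bernstein {N M : ℕ} (hMN : M ≤ N) :
    bestMPoly N M = ∑ i ∈ Finset.range M,
      C (((M : ℝ) - i) / M * N.choose i) * (X ^ (N - i) * (1 - X) ^ i) := by
  have hexp : ∀ i ∈ Finset.range M, C (((M : ℝ) - i) / M * N.choose i) *
      (X ^ (N - i) * (1 - X) ^ i) = ∑ m ∈ Finset.range (i + 1),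
        C (((M : ℝ) - i) / M * (N.choose i) * (i.choose m) * (-1 : ℝ) ^ (i - m)) *
          X ^ (N - m) := by
    intro i hi
    rw [Finset.mem_range] at hi
    rw [show (1 - X : ℝ[X]) = 1 + -X by ring, add_pow, Finset.mul_sum, Finset.mul_sum]
    refine Finset.sum_congr rfl fun m hm => ?_
    rw [Finset.mem_range] at hm
    rw [show N - m = (N - i) + (i - m) by omega, pow_add, neg_pow]
    simp only [map_mul, map_pow, map_neg, map_one, map_natCast, one_pow]
    ring
  rw [Finset.sum_congr rfl hexp, bestMPoly]
  simp only [xi1, map_sum, Finset.sum_mul]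
  refine Finset.sum_comm' fun m i => ?_
  simp only [Finset.mem_range, Finset.mem_Icc]
  omega

theorem bestMPoly_eval_one {N M : ℕ} (hM : 1 ≤ M) (hMN : M ≤ N) :
    (bestMPoly N M).eval 1 = 1 := by
  obtain ⟨k, rfl⟩ : ∃ k, M = k + 1 := ⟨M - 1, by omega⟩
  have hk : (k : ℝ) + 1 ≠ 0 := by positivity
  simp [bestMPoly_eq_sum_bernstein hMN, Polynomial.eval_finsetSum, Finset.sum_range_succ', hk]

open Polynomial in
theorem bestMPoly_derivative_eval_one {N M : ℕ} (hM : 1 ≤ M) (hMN : M ≤ N) :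
    (derivative (bestMPoly N M)).eval 1 = (N : ℝ) / M := by
  obtain ⟨k, rfl⟩ : ∃ k, M = k + 1 := ⟨M - 1, by omega⟩
  have hk : (k : ℝ) + 1 ≠ 0 := by positivity
  rw [bestMPoly_eq_sum_bernstein hMN, derivative_sum, Polynomial.eval_finsetSum]
  rcases k with _ | k
  · simp [derivative_X_pow]
  · rw [Finset.sum_range_succ', Finset.sum_range_succ']
    have hk' : (k : ℝ) + 1 + 1 ≠ 0 := by positivity
    simp [derivative_mul, derivative_pow, hk']
    field_simp
    ring

/-- Composing with a polynomial that fixes `1` and has nonzero derivative there preserves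
the von Mises limit. -/
theorem tendsto_vonMises_polynomial_comp {α : Type*} {l : Filter α} {F f f' : α → ℝ}
    (P : Polynomial ℝ) (hP : P.eval 1 = 1) (hP' : P.derivative.eval 1 ≠ 0)
    (hF1 : ∀ᶠ x in l, F x ≠ 1) (hF : Tendsto F l (nhds 1)) (hf : ∀ᶠ x in l, f x ≠ 0)
    (h : Tendsto (fun x => (F x - 1) * f' x / (f x) ^ 2) l (nhds 1)) :
    Tendsto (fun x => (P.eval (F x) - 1) *
      (P.derivative.derivative.eval (F x) * f x ^ 2 + P.derivative.eval (F x) * f' x) /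
      (P.derivative.eval (F x) * f x) ^ 2) l (nhds 1) := by
  have hslope : Tendsto (fun x => (P.eval (F x) - 1) / (F x - 1)) l
      (nhds (P.derivative.eval 1)) := by
    have := (hasDerivAt_iff_tendsto_slope.1 (P.hasDerivAt 1)).comp
      (tendsto_nhdsWithin_iff.2 ⟨hF, hF1⟩)
    refine this.congr fun x => ?_
    simp [slope_def_field, hP]
  have hd : Tendsto (fun x => P.derivative.eval (F x)) l (nhds (P.derivative.eval 1)) :=
    (P.derivative.continuous.tendsto 1).comp hF
  have hdd : Tendsto (fun x => P.derivative.derivative.eval (F x)) l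
      (nhds (P.derivative.derivative.eval 1)) :=
    (P.derivative.derivative.continuous.tendsto 1).comp hF
  have hlim := hslope.mul ((((hF.sub_const 1).mul hdd).div (hd.pow 2) (pow_ne_zero 2 hP')).add
    (h.div hd hP'))
  have hval : P.derivative.eval 1 * ((1 - 1) * P.derivative.derivative.eval 1 /
      P.derivative.eval 1 ^ 2 + 1 / P.derivative.eval 1) = 1 := by
    field_simp
    ring
  rw [hval] at hlim
  refine hlim.congr' ?_
  filter_upwards [hF1, hf, hd.eventually_ne hP'] with x hx hfx hdx
  have hx' : F x - 1 ≠ 0 := sub_ne_zero.2 hx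
  simp only [Pi.div_apply]
  field_simp

theorem bestM_preserves_gumbel_condition (N M : ℕ) (hM : 1 ≤ M) (hMN : M ≤ N)
    (F f f' : ℝ → ℝ)
    (hderivF : ∀ x, HasDerivAt F (f x) x)
    (hderivf : ∀ x, HasDerivAt f (f' x) x)
    (hF01 : ∀ x, 0 ≤ F x ∧ F x < 1)
    (hFlim : Tendsto F atTop (nhds 1))
    (hfpos : ∀ᶠ x in atTop, 0 < f x)
    (hvonMises : Tendsto (fun x => (F x - 1) * f' x / (f x) ^ 2) atTop (nhds 1))
    (FY fY fY' : ℝ → ℝ)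
    (hFY : ∀ x, FY x = ∑ m ∈ Finset.range M, xi1 N M m * (F x) ^ (N - m))
    (hfY : ∀ x, fY x = ∑ m ∈ Finset.range M, xi1 N M m * (N - m : ℝ) * (F x) ^ (N - m - 1) * f x)
    (hfY' : ∀ x, fY' x = ∑ m ∈ Finset.range M, xi1 N M m * (N - m : ℝ) *
      ((N - m - 1 : ℝ) * (F x) ^ (N - m - 2) * (f x) ^ 2 + (F x) ^ (N - m - 1) * f' x)) :
    Tendsto (fun x => (FY x - 1) * fY' x / (fY x) ^ 2) atTop (nhds 1) := by
  have hcast : ∀ m ∈ Finset.range M, ((N - m : ℕ) : ℝ) = (N : ℝ) - m := fun m hm =>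
    Nat.cast_sub ((Finset.mem_range.1 hm).le.trans hMN)
  have hcast' : ∀ m ∈ Finset.range M, ((N - m - 1 : ℕ) : ℝ) = (N : ℝ) - m - 1 := fun m hm => by
    rw [Nat.cast_sub (by have := Finset.mem_range.1 hm; omega), hcast m hm, Nat.cast_one]
  have hY : ∀ x, FY x = (bestMPoly N M).eval (F x) := fun x => by
    simp [hFY, bestMPoly, Polynomial.eval_finsetSum]
  have hY' : ∀ x, fY x = (bestMPoly N M).derivative.eval (F x) * f x := fun x => by
    rw [hfY, bestMPoly, Polynomial.derivative_sum, Polynomial.eval_finsetSum, Finset.sum_mul]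
    refine Finset.sum_congr rfl fun m hm => ?_
    rw [← hcast m hm]
    simp [Polynomial.derivative_X_pow, mul_assoc]
  have hY'' : ∀ x, fY' x = (bestMPoly N M).derivative.derivative.eval (F x) * f x ^ 2 +
      (bestMPoly N M).derivative.eval (F x) * f' x := fun x => by
    rw [hfY', bestMPoly, Polynomial.derivative_sum, Polynomial.derivative_sum,
      Polynomial.eval_finsetSum, Polynomial.eval_finsetSum, Finset.sum_mul, Finset.sum_mul,
      ← Finset.sum_add_distrib]
    refine Finset.sum_congr rfl fun m hm => ?_
    rw [← hcast' m hm, ← hcast m hm]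
    simp only [Polynomial.derivative_C_mul_X_pow, Polynomial.eval_mul, Polynomial.eval_C,
      Polynomial.eval_pow, Polynomial.eval_X, Nat.sub_sub]
    ring
  simp only [hY, hY', hY'']
  refine tendsto_vonMises_polynomial_comp _ (bestMPoly_eval_one hM hMN) ?_
    (Eventually.of_forall fun x => (hF01 x).2.ne) hFlim (hfpos.mono fun x hx => hx.ne') hvonMises
  rw [bestMPoly_derivative_eval_one hM hMN]
  have hM0 : (M : ℝ) ≠ 0 := Nat.cast_ne_zero.2 (by omega)
  have hN0 : (N : ℝ) ≠ 0 := Nat.cast_ne_zero.2 (by omega)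
  exact div_ne_zero hN0 hM0
end

section
/- Let J ≥ 1 be an integer, ρ_0 > 0, and ρ_1, …, ρ_J pairwise distinct positive reals with ϖ_b = ∏_{i=1, i≠b}^{J} ρ_b/(ρ_b − ρ_i). Let F_Z(x) = 1 − Σ_{b=1}^{J} ϖ_b e^{−x/ρ_0} ρ_0/(ρ_0 + ρ_b x) and f_Z(x) = Σ_{b=1}^{J} ϖ_b e^{−x/ρ_0} ( 1/(ρ_0 + ρ_b x) + ρ_0 ρ_b/(ρ_0 + ρ_b x)^2 ). Then lim_{x→∞} (1 − F_Z(x))/f_Z(x) = ρ_0, and, with f_Z' denoting the derivative of f_Z, lim_{x→∞} f_Z'(x)/f_Z(x) = −1/ρ_0. -/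
open Filter Finset Real

/-- Partial fraction decomposition of `∏ b, (1 + ρ b * s)⁻¹`. -/
theorem sum_mul_inv_one_add_mul {ι : Type*} [Fintype ι] [DecidableEq ι] [Nonempty ι]
    {ρ : ι → ℝ} (hρ : ∀ b, ρ b ≠ 0) (hinj : Function.Injective ρ) {s : ℝ}
    (hs : ∀ b, 1 + ρ b * s ≠ 0) :
    ∑ b, (∏ i ∈ Finset.univ.erase b, ρ b / (ρ b - ρ i)) * (1 + ρ b * s)⁻¹ =
      ∏ b, (1 + ρ b * s)⁻¹ := by
  have hv : Set.InjOn (fun b => -(ρ b)⁻¹) (Finset.univ : Finset ι) := fun a _ b _ h =>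
    hinj (inv_injective (neg_injective h))
  have key := congrArg (Polynomial.eval s) (Lagrange.sum_basis hv Finset.univ_nonempty)
  rw [Polynomial.eval_finsetSum, Polynomial.eval_one] at key
  refine Eq.trans ?_ ((congrArg (· * ∏ b, (1 + ρ b * s)⁻¹) key).trans (one_mul _))
  simp only [Finset.sum_mul]
  refine Finset.sum_congr rfl fun b _ => ?_
  rw [Lagrange.basis, Polynomial.eval_prod,
    ← Finset.mul_prod_erase Finset.univ _ (Finset.mem_univ b), mul_left_comm,
    ← Finset.prod_mul_distrib, mul_comm]
  congr 1
  refine Finset.prod_congr rfl fun i hi => ?_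
  have hne : ρ b - ρ i ≠ 0 := sub_ne_zero.2 fun h => Finset.ne_of_mem_erase hi (hinj h.symm)
  have hne' : -(ρ b)⁻¹ - -(ρ i)⁻¹ = (ρ b - ρ i) / (ρ b * ρ i) := by
    have := hρ b
    have := hρ i
    field_simp
    ring
  have := hρ b
  have := hρ i
  have := hs i
  simp only [Lagrange.basisDivisor, Polynomial.eval_mul, Polynomial.eval_C, Polynomial.eval_sub,
    Polynomial.eval_X, hne']
  field_simp
  ring

theorem hasDerivAt_prod_div_add_mul {ι : Type*} (t : Finset ι) {a : ℝ} {ρ : ι → ℝ} {x : ℝ}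
    (hx : ∀ b, a + ρ b * x ≠ 0) :
    HasDerivAt (fun y => ∏ b ∈ t, a / (a + ρ b * y))
      (-((∏ b ∈ t, a / (a + ρ b * x)) * ∑ b ∈ t, ρ b / (a + ρ b * x))) x := by
  classical
  induction t using Finset.induction_on with
  | empty => simpa using hasDerivAt_const x (1 : ℝ)
  | insert c t hc ih =>
    simp only [Finset.prod_insert hc, Finset.sum_insert hc]
    have hlin : HasDerivAt (fun y => a + ρ c * y) (ρ c) x := by
      simpa using ((hasDerivAt_id x).const_mul (ρ c)).const_add a
    refine (((hasDerivAt_const x a).fun_div hlin (hx c)).fun_mul ih).congr_deriv ?_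
    have := hx c
    field_simp
    ring

theorem tendsto_const_div_add_mul_atTop (c a : ℝ) {r : ℝ} (hr : 0 < r) :
    Tendsto (fun x : ℝ => c / (a + r * x)) atTop (nhds 0) :=
  (tendsto_atTop_add_const_left _ a (tendsto_id.const_mul_atTop hr)).const_div_atTop c

theorem sinr_hazard_limits (J : ℕ) (hJ : 1 ≤ J)
    (ρ₀ : ℝ) (hρ₀ : 0 < ρ₀)
    (ρ : Fin J → ℝ) (hρpos : ∀ b, 0 < ρ b) (hρdist : Function.Injective ρ)
    (ϖ : Fin J → ℝ)
    (hϖ : ∀ b, ϖ b = ∏ i ∈ Finset.univ.erase b, ρ b / (ρ b - ρ i))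
    (FZ fZ : ℝ → ℝ)
    (hFZ : ∀ x, FZ x = 1 - ∑ b, ϖ b * Real.exp (-x / ρ₀) * (ρ₀ / (ρ₀ + ρ b * x)))
    (hfZ : ∀ x, fZ x = ∑ b, ϖ b * Real.exp (-x / ρ₀) *
      (1 / (ρ₀ + ρ b * x) + ρ₀ * ρ b / (ρ₀ + ρ b * x) ^ 2)) :
    Tendsto (fun x => (1 - FZ x) / fZ x) atTop (nhds ρ₀) ∧
    Tendsto (fun x => deriv fZ x / fZ x) atTop (nhds (-1 / ρ₀)) := by
  have : Nonempty (Fin J) := ⟨⟨0, hJ⟩⟩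
  set h : ℝ → ℝ := fun x => ∑ b, ρ b / (ρ₀ + ρ b * x) with hh
  set k : ℝ → ℝ := fun x => ∑ b, (ρ b / (ρ₀ + ρ b * x)) ^ 2 with hk
  have hden : ∀ x, 0 < x → ∀ b, 0 < ρ₀ + ρ b * x := fun x hx b => by
    have := hρpos b
    positivity
  have hlin : ∀ x b, HasDerivAt (fun y => ρ₀ + ρ b * y) (ρ b) x := fun x b => by
    simpa using ((hasDerivAt_id x).const_mul (ρ b)).const_add ρ₀
  have hexp : ∀ x, HasDerivAt (fun y => Real.exp (-y / ρ₀)) (Real.exp (-x / ρ₀) * (-1 / ρ₀)) x :=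
    fun x => ((hasDerivAt_neg x).div_const ρ₀).exp
  have hprod : ∀ x, 0 < x →
      1 - FZ x = Real.exp (-x / ρ₀) * ∏ b, ρ₀ / (ρ₀ + ρ b * x) := fun x hx => by
    have hrw : ∀ b, ρ₀ / (ρ₀ + ρ b * x) = (1 + ρ b * (x / ρ₀))⁻¹ := fun b => by
      have := (hden x hx b).ne'
      field_simp
    have hs : ∀ b, 1 + ρ b * (x / ρ₀) ≠ 0 := fun b => by
      have := hρpos b
      positivity
    simp only [hFZ, sub_sub_cancel, hrw, hϖ]
    rw [← sum_mul_inv_one_add_mul (fun b => (hρpos b).ne') hρdist hs, Finset.mul_sum]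
    exact Finset.sum_congr rfl fun b _ => by ring
  have hderiv : ∀ x, 0 < x → HasDerivAt (fun y => 1 - FZ y) (-fZ x) x := fun x hx => by
    simp only [hFZ, sub_sub_cancel]
    refine (HasDerivAt.fun_sum fun b _ => ((hexp x).const_mul (ϖ b)).fun_mul
      ((hasDerivAt_const x ρ₀).fun_div (hlin x b) (hden x hx b).ne')).congr_deriv ?_
    rw [hfZ, ← Finset.sum_neg_distrib]
    refine Finset.sum_congr rfl fun b _ => ?_
    have := (hden x hx b).ne'
    field_simp
    ring
  have hf : ∀ x, 0 < x → fZ x = (1 - FZ x) * (1 / ρ₀ + h x) := fun x hx => by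
    have hd := ((hexp x).fun_mul (hasDerivAt_prod_div_add_mul Finset.univ
      fun b => (hden x hx b).ne')).congr_of_eventuallyEq
        ((eventually_gt_nhds hx).mono fun y hy => hprod y hy)
    have := (hderiv x hx).unique hd
    rw [hprod x hx]
    linear_combination -this
  have hpos : ∀ x, 0 < x → 0 < 1 - FZ x := fun x hx => by
    rw [hprod x hx]
    exact mul_pos (Real.exp_pos _) (Finset.prod_pos fun b _ => div_pos hρ₀ (hden x hx b))
  have hhpos : ∀ x, 0 < x → 0 < 1 / ρ₀ + h x := fun x hx =>
    add_pos_of_pos_of_nonneg (by positivity)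
      (Finset.sum_nonneg fun b _ => (div_pos (hρpos b) (hden x hx b)).le)
  have hhderiv : ∀ x, 0 < x → HasDerivAt h (-k x) x := fun x hx => by
    refine (HasDerivAt.fun_sum fun b _ => (hasDerivAt_const x (ρ b)).fun_div (hlin x b)
      (hden x hx b).ne').congr_deriv ?_
    rw [hk, ← Finset.sum_neg_distrib]
    refine Finset.sum_congr rfl fun b _ => ?_
    rw [div_pow]
    ring
  have hratio : ∀ x, 0 < x → (1 - FZ x) / fZ x = (1 / ρ₀ + h x)⁻¹ := fun x hx => by
    rw [hf x hx, div_mul_cancel_left₀ (hpos x hx).ne']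
  have hlogf : ∀ x, 0 < x →
      deriv fZ x / fZ x = -(1 / ρ₀ + h x) - (1 / ρ₀ + h x)⁻¹ * k x := fun x hx => by
    have hd : HasDerivAt fZ (-fZ x * (1 / ρ₀ + h x) + (1 - FZ x) * -k x) x :=
      ((hderiv x hx).fun_mul ((hhderiv x hx).const_add (1 / ρ₀))).congr_of_eventuallyEq
        ((eventually_gt_nhds hx).mono fun y hy => hf y hy)
    have hfne : fZ x ≠ 0 := by
      rw [hf x hx]
      exact (mul_pos (hpos x hx) (hhpos x hx)).ne'
    rw [hd.deriv, ← hratio x hx]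
    field_simp
    ring
  have hhlim : Tendsto (fun x => 1 / ρ₀ + h x) atTop (nhds (1 / ρ₀)) := by
    simpa using (tendsto_finsetSum Finset.univ fun b _ =>
      tendsto_const_div_add_mul_atTop (ρ b) ρ₀ (hρpos b)).const_add (1 / ρ₀)
  have hklim : Tendsto k atTop (nhds 0) := by
    simpa using tendsto_finsetSum Finset.univ fun b _ =>
      (tendsto_const_div_add_mul_atTop (ρ b) ρ₀ (hρpos b)).pow 2
  have hinv : Tendsto (fun x => (1 / ρ₀ + h x)⁻¹) atTop (nhds ρ₀) := by
    simpa using hhlim.inv₀ (one_div_pos.2 hρ₀).ne'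
  constructor
  · exact hinv.congr' ((eventually_gt_atTop 0).mono fun x hx => (hratio x hx).symm)
  · have hlim := hhlim.neg.sub (hinv.mul hklim)
    rw [mul_zero, sub_zero, ← neg_div] at hlim
    exact hlim.congr' ((eventually_gt_atTop 0).mono fun x hx => (hlogf x hx).symm)
end

section
/- Let J ≥ 1 be an integer, ρ_0 > 0, and ρ_1, …, ρ_J pairwise distinct positive reals with ϖ_b = ∏_{i=1, i≠b}^{J} ρ_b/(ρ_b − ρ_i). Let F_Z(x) = 1 − Σ_{b=1}^{J} ϖ_b e^{−x/ρ_0} ρ_0/(ρ_0 + ρ_b x) and f_Z(x) = Σ_{b=1}^{J} ϖ_b e^{−x/ρ_0} ( 1/(ρ_0 + ρ_b x) + ρ_0 ρ_b/(ρ_0 + ρ_b x)^2 ). Then the von Mises condition for the Gumbel domain of attraction holds: lim_{x→∞} (d/dx)[ (1 − F_Z(x))/f_Z(x) ] = 0. -/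
open Filter Finset Real

/-- Partial fraction expansion of `∏ c / (c + ρ b * x)`. -/
lemma sum_partial_fractions_eq_prod {J : ℕ} (hJ : 1 ≤ J) {c : ℝ} (hc : 0 < c)
    {ρ : Fin J → ℝ} (hρpos : ∀ b, 0 < ρ b) (hρdist : Function.Injective ρ)
    {x : ℝ} (hx : 0 < x) :
    ∑ b, (∏ i ∈ Finset.univ.erase b, ρ b / (ρ b - ρ i)) * (c / (c + ρ b * x))
      = ∏ b, c / (c + ρ b * x) := by
  have hd : ∀ b, 0 < c + ρ b * x := fun b => by have := hρpos b; positivity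
  have hne : (Finset.univ : Finset (Fin J)).Nonempty := ⟨⟨0, hJ⟩, Finset.mem_univ _⟩
  have hinj : Set.InjOn (fun b => -c / ρ b) (Finset.univ : Finset (Fin J)) := by
    intro a _ b _ hab
    apply hρdist
    have ha := (hρpos a).ne'
    have hb := (hρpos b).ne'
    simp only at hab
    rw [div_eq_div_iff ha hb] at hab
    exact (mul_left_cancel₀ (neg_ne_zero.mpr hc.ne') hab).symm
  have hbasis := congrArg (Polynomial.eval x) (Lagrange.sum_basis hinj hne)
  rw [Polynomial.eval_finsetSum, Polynomial.eval_one] at hbasis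
  rw [← mul_one (∏ b, c / (c + ρ b * x)), ← hbasis, Finset.mul_sum]
  refine Finset.sum_congr rfl fun b _ => ?_
  rw [← Finset.mul_prod_erase _ _ (Finset.mem_univ b), Lagrange.basis,
    Polynomial.eval_prod, mul_assoc, ← Finset.prod_mul_distrib, mul_comm]
  congr 1
  refine Finset.prod_congr rfl fun i hi => ?_
  have hbi : ρ b - ρ i ≠ 0 :=
    sub_ne_zero.mpr fun h => (Finset.ne_of_mem_erase hi) (hρdist h).symm
  have ha := (hρpos i).ne'
  have hb := (hρpos b).ne'
  have hdi := (hd i).ne'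
  have hnode : -c / ρ b - -c / ρ i = c * (ρ b - ρ i) / (ρ b * ρ i) := by
    field_simp
    ring
  simp only [Lagrange.basisDivisor, Polynomial.eval_mul, Polynomial.eval_C,
    Polynomial.eval_sub, Polynomial.eval_X, hnode]
  field_simp
  ring

lemma hasDerivAt_const_div_affine {c r x : ℝ} (a : ℝ) (h : c + r * x ≠ 0) :
    HasDerivAt (fun y => a / (c + r * y)) (-(a * r / (c + r * x) ^ 2)) x := by
  have h1 : HasDerivAt (fun y => c + r * y) r x := by
    simpa using ((hasDerivAt_id x).const_mul r).const_add c
  refine ((hasDerivAt_const x a).fun_div h1 h).congr_deriv ?_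
  ring

/-- The derivative of the partial fraction expansion is minus the logarithmic sum times the
product. -/
lemma sum_deriv_partial_fractions {J : ℕ} (hJ : 1 ≤ J) {c : ℝ} (hc : 0 < c)
    {ρ : Fin J → ℝ} (hρpos : ∀ b, 0 < ρ b) (hρdist : Function.Injective ρ)
    {x : ℝ} (hx : 0 < x) :
    ∑ b, (∏ i ∈ Finset.univ.erase b, ρ b / (ρ b - ρ i)) * (c * ρ b / (c + ρ b * x) ^ 2)
      = (∏ b, c / (c + ρ b * x)) * ∑ b, ρ b / (c + ρ b * x) := by
  have hd : ∀ b, c + ρ b * x ≠ 0 := fun b => by have := hρpos b; positivity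
  have hsum : HasDerivAt (fun y => ∑ b, (∏ i ∈ Finset.univ.erase b, ρ b / (ρ b - ρ i)) *
      (c / (c + ρ b * y))) _ x := HasDerivAt.fun_sum fun b _ =>
    (hasDerivAt_const_div_affine c (hd b)).const_mul _
  have hprod : HasDerivAt (fun y => ∏ b, c / (c + ρ b * y)) _ x :=
    HasDerivAt.fun_finsetProd fun b _ => hasDerivAt_const_div_affine c (hd b)
  have heq : (fun y => ∑ b, (∏ i ∈ Finset.univ.erase b, ρ b / (ρ b - ρ i)) *
      (c / (c + ρ b * y))) =ᶠ[nhds x] fun y => ∏ b, c / (c + ρ b * y) := by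
    filter_upwards [lt_mem_nhds hx] with y hy
    exact sum_partial_fractions_eq_prod hJ hc hρpos hρdist hy
  have h := hsum.unique (hprod.congr_of_eventuallyEq heq)
  simp only [mul_neg, smul_eq_mul, Finset.sum_neg_distrib, neg_inj] at h
  rw [h, Finset.mul_sum]
  refine Finset.sum_congr rfl fun b _ => ?_
  rw [← Finset.mul_prod_erase _ _ (Finset.mem_univ b), sq, ← div_mul_div_comm]
  ring

theorem sinr_gumbel_vonMises (J : ℕ) (hJ : 1 ≤ J)
    (ρ₀ : ℝ) (hρ₀ : 0 < ρ₀)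
    (ρ : Fin J → ℝ) (hρpos : ∀ b, 0 < ρ b) (hρdist : Function.Injective ρ)
    (ϖ : Fin J → ℝ)
    (hϖ : ∀ b, ϖ b = ∏ i ∈ Finset.univ.erase b, ρ b / (ρ b - ρ i))
    (FZ fZ : ℝ → ℝ)
    (hFZ : ∀ x, FZ x = 1 - ∑ b, ϖ b * Real.exp (-x / ρ₀) * (ρ₀ / (ρ₀ + ρ b * x)))
    (hfZ : ∀ x, fZ x = ∑ b, ϖ b * Real.exp (-x / ρ₀) *
      (1 / (ρ₀ + ρ b * x) + ρ₀ * ρ b / (ρ₀ + ρ b * x) ^ 2)) :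
    Tendsto (deriv fun x => (1 - FZ x) / fZ x) atTop (nhds 0) := by
  have hd : ∀ x, 0 < x → ∀ b, 0 < ρ₀ + ρ b * x := fun x hx b => by
    have := hρpos b; positivity
  have hpos : ∀ x, 0 < x → 0 < 1 / ρ₀ + ∑ b, ρ b / (ρ₀ + ρ b * x) := fun x hx =>
    add_pos_of_pos_of_nonneg (by positivity)
      (Finset.sum_nonneg fun b _ => (div_pos (hρpos b) (hd x hx b)).le)
  have hratio : ∀ x, 0 < x →
      (1 - FZ x) / fZ x = 1 / (1 / ρ₀ + ∑ b, ρ b / (ρ₀ + ρ b * x)) := by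
    intro x hx
    have hS := sum_partial_fractions_eq_prod hJ hρ₀ hρpos hρdist hx
    have hS' := sum_deriv_partial_fractions hJ hρ₀ hρpos hρdist hx
    simp only [← hϖ] at hS hS'
    have hP : 0 < ∏ b, ρ₀ / (ρ₀ + ρ b * x) :=
      Finset.prod_pos fun b _ => div_pos hρ₀ (hd x hx b)
    have hF : 1 - FZ x = Real.exp (-x / ρ₀) * ∏ b, ρ₀ / (ρ₀ + ρ b * x) := by
      rw [hFZ, ← hS, Finset.mul_sum, sub_sub_cancel]
      exact Finset.sum_congr rfl fun b _ => by ring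
    have hf : fZ x = Real.exp (-x / ρ₀) * (∏ b, ρ₀ / (ρ₀ + ρ b * x)) *
        (1 / ρ₀ + ∑ b, ρ b / (ρ₀ + ρ b * x)) := by
      rw [mul_assoc, mul_add, ← hS', ← hS, Finset.sum_mul, ← Finset.sum_add_distrib,
        Finset.mul_sum, hfZ]
      refine Finset.sum_congr rfl fun b _ => ?_
      have := (hd x hx b).ne'
      field_simp
    rw [hF, hf, div_mul_eq_div_div, div_self (by positivity)]
  have hderiv : ∀ x, 0 < x → deriv (fun x => (1 - FZ x) / fZ x) x =
      (∑ b, (ρ b / (ρ₀ + ρ b * x)) ^ 2) / (1 / ρ₀ + ∑ b, ρ b / (ρ₀ + ρ b * x)) ^ 2 := by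
    intro x hx
    have heq : (fun x => (1 - FZ x) / fZ x) =ᶠ[nhds x]
        fun x => 1 / (1 / ρ₀ + ∑ b, ρ b / (ρ₀ + ρ b * x)) := by
      filter_upwards [lt_mem_nhds hx] with y hy using hratio y hy
    have hg : HasDerivAt (fun y => 1 / ρ₀ + ∑ b, ρ b / (ρ₀ + ρ b * y)) _ x :=
      (HasDerivAt.fun_sum fun b _ =>
        hasDerivAt_const_div_affine (ρ b) (hd x hx b).ne').const_add _
    rw [heq.deriv_eq, ((hasDerivAt_const x (1 : ℝ)).fun_div hg (hpos x hx).ne').deriv]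
    simp only [Finset.sum_neg_distrib, div_pow, sq (ρ _)]
    ring
  have hterm : ∀ b, Tendsto (fun x => ρ b / (ρ₀ + ρ b * x)) atTop (nhds 0) := fun b =>
    (tendsto_atTop_add_const_left _ _
      (tendsto_id.const_mul_atTop (hρpos b))).const_div_atTop _
  have hnum : Tendsto (fun x => ∑ b, (ρ b / (ρ₀ + ρ b * x)) ^ 2) atTop (nhds 0) := by
    simpa using tendsto_finsetSum Finset.univ fun b _ => (hterm b).pow 2
  have hden : Tendsto (fun x => (1 / ρ₀ + ∑ b, ρ b / (ρ₀ + ρ b * x)) ^ 2) atTop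
      (nhds ((1 / ρ₀) ^ 2)) := by
    simpa using ((tendsto_finsetSum Finset.univ fun b _ => hterm b).const_add (1 / ρ₀)).pow 2
  have hlim := hnum.div hden (by positivity)
  rw [zero_div] at hlim
  refine hlim.congr' ?_
  filter_upwards [eventually_gt_atTop 0] with x hx using (hderiv x hx).symm
end
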